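/- For every n ≥ 0, a(n, 0) = c(n, 0). -/

import Mathlib

/- `a n k` and `b n k` satisfy `a n k = b (n-1) (k-1) + a (n-1) (k+1)` and
`b n k = a (n-1) k + b (n-1) (k+1)`, where a term with second index `-1` is
interpreted as `0`, with initial values `a 0 0 = 1`, `b 0 0 = 0` and
`a 0 k = b 0 k = 0` for `k ≥ 1`. -/
mutual
  def a : ℕ → ℕ → ℕ
    | 0, 0 => 1
    | 0, _ + 1 => 0
    | n + 1, 0 => a n 1
    | n + 1, k + 1 => b n k + a n (k + 2)
  def b : ℕ → ℕ → ℕ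
    | 0, _ => 0
    | n + 1, k => a n k + b n (k + 1)
end

/- `c n k` and `d n k` satisfy `c n k = c (n-1) (k-1) + d (n-1) k` and
`d n k = d (n-1) (k-1) + c (n-1) (k+1)`, where a term with second index `-1` is
interpreted as `0`, with initial values `c 0 0 = 1`, `d 0 0 = 0` and
`c 0 k = d 0 k = 0` for `k ≥ 1`. -/
mutual
  def c : ℕ → ℕ → ℕ
    | 0, 0 => 1
    | 0, _ + 1 => 0
    | n + 1, 0 => d n 0
    | n + 1, k + 1 => c n k + d n (k + 1)
  def d : ℕ → ℕ → ℕ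
    | 0, _ => 0
    | n + 1, 0 => c n 1
    | n + 1, k + 1 => d n k + c n (k + 2)
end

/-- `a n` and `b n` are supported on indices at most `n`. -/
theorem a_b_eq_zero_of_lt (n : ℕ) : ∀ k, n < k → a n k = 0 ∧ b n k = 0 := by
  induction n with
  | zero =>
    rintro (_ | k) hk
    · omega
    · simp [a, b]
  | succ n ih =>
    rintro (_ | k) hk
    · omega
    · simp [a, b, ih k (by omega), ih (k + 1) (by omega), ih (k + 2) (by omega)]

/-- The truncated pairing of row `m` of `(a, b)` with row `n` of `(c, d)`. -/
def pairing (K m n : ℕ) : ℕ :=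
  ∑ k ∈ Finset.range K, (a m k * c n k + b m k * d n k)

/-- The recurrences for `(a, b)` and `(c, d)` are adjoint up to boundary terms. -/
theorem pairing_succ_left_add (K m n : ℕ) :
    pairing (K + 1) (m + 1) n + b m K * c n (K + 1) =
      pairing (K + 1) m (n + 1) + (a m (K + 1) * c n K + b m (K + 1) * d n K) := by
  induction K with
  | zero =>
    simp only [pairing, Finset.sum_range_succ, Finset.sum_range_zero, a, b, c, d]
    ring
  | succ K ih =>
    rw [pairing, pairing, Finset.sum_range_succ, Finset.sum_range_succ _ (K + 1),
      ← pairing, ← pairing]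
    simp only [a, b, c, d]
    linarith

theorem pairing_succ_left {K m : ℕ} (hm : m < K) (n : ℕ) :
    pairing (K + 1) (m + 1) n = pairing (K + 1) m (n + 1) := by
  simpa [a_b_eq_zero_of_lt m K hm, a_b_eq_zero_of_lt m (K + 1) (by omega)]
    using pairing_succ_left_add K m n

theorem pairing_add_left {K m : ℕ} (hm : m ≤ K) (n : ℕ) :
    pairing (K + 1) m n = pairing (K + 1) 0 (n + m) := by
  induction m generalizing n with
  | zero => rfl
  | succ m ih => rw [pairing_succ_left (by omega), ih (by omega), Nat.add_right_comm, Nat.add_assoc]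

theorem pairing_zero_left (K n : ℕ) : pairing (K + 1) 0 n = c n 0 := by
  simp [pairing, Finset.sum_range_succ', a, b]

theorem pairing_zero_right (K m : ℕ) : pairing (K + 1) m 0 = a m 0 := by
  simp [pairing, Finset.sum_range_succ', c, d]

theorem a_eq_c (n : ℕ) : a n 0 = c n 0 := by
  rw [← pairing_zero_right n n, pairing_add_left le_rfl, pairing_zero_left, Nat.zero_add]
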